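/- Let U ⊆ E be open in a finite-dimensional real normed space and L : U → (E →L[ℝ] E) a smooth field of operators whose Haantjes tensor vanishes identically on U. Then for every m ∈ ℕ and all smooth functions a₀,…,a_m : U → ℝ, the field of operators x ↦ Σ_{j=0}^m a_j(x)·L(x)^j also has identically vanishing Haantjes tensor. (Paper: Proposition 2.9.) -/

import Mathlib

variable {E : Type*} [NormedAddCommGroup E] [NormedSpace ℝ E]

/-- Lie bracket of vector fields on a normed space:
`[X,Y](x) = (fderiv Y x)(X x) − (fderiv X x)(Y x)`. -/
noncomputable def lieBracket (X Y : E → E) : E → E :=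
  fun x => fderiv ℝ Y x (X x) - fderiv ℝ X x (Y x)

/-- The vector field `LX : x ↦ L(x)(X(x))`. -/
noncomputable def opVec (L : E → (E →L[ℝ] E)) (X : E → E) : E → E :=
  fun x => L x (X x)

/-- Nijenhuis torsion of a field of operators:
`T_L(X,Y) = L²[X,Y] + [LX,LY] − L([X,LY] + [LX,Y])`. -/
noncomputable def nijenhuisTorsion (L : E → (E →L[ℝ] E)) (X Y : E → E) : E → E :=
  fun x =>
    L x (L x (lieBracket X Y x)) + lieBracket (opVec L X) (opVec L Y) x
      - L x (lieBracket X (opVec L Y) x + lieBracket (opVec L X) Y x)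

/-- Haantjes tensor of a field of operators:
`H_L(X,Y) = L²T_L(X,Y) + T_L(LX,LY) − L(T_L(X,LY) + T_L(LX,Y))`. -/
noncomputable def haantjesTensor (L : E → (E →L[ℝ] E)) (X Y : E → E) : E → E :=
  fun x =>
    L x (L x (nijenhuisTorsion L X Y x)) + nijenhuisTorsion L (opVec L X) (opVec L Y) x
      - L x (nijenhuisTorsion L X (opVec L Y) x + nijenhuisTorsion L (opVec L X) Y x)

/-- Postcomposition of the values of a bilinear map with an operator. -/
noncomputable def postcompOut (A : E →L[ℝ] E) : Module.End ℝ (E →L[ℝ] E →L[ℝ] E) where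
  toFun B := (ContinuousLinearMap.compL ℝ E E E A).comp B
  map_add' B C := by ext; simp
  map_smul' c B := by ext; simp

/-- Precomposition of a bilinear map with an operator in the first argument. -/
noncomputable def precompFst (A : E →L[ℝ] E) : Module.End ℝ (E →L[ℝ] E →L[ℝ] E) where
  toFun B := B.comp A
  map_add' B C := by ext; simp
  map_smul' c B := by ext; simp

/-- Precomposition of a bilinear map with an operator in the second argument. -/
noncomputable def precompSnd (A : E →L[ℝ] E) : Module.End ℝ (E →L[ℝ] E →L[ℝ] E) where
  toFun B := ((ContinuousLinearMap.compL ℝ E E E).flip A).comp B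
  map_add' B C := by ext; simp
  map_smul' c B := by ext; simp

/-- The exchange of the two arguments of a bilinear map. -/
noncomputable def swapArgs : Module.End ℝ (E →L[ℝ] E →L[ℝ] E) where
  toFun B := B.flip
  map_add' B C := by ext; simp
  map_smul' c B := by ext; simp

@[simp]
theorem postcompOut_apply (A : E →L[ℝ] E) (B : E →L[ℝ] E →L[ℝ] E) (u v : E) :
    postcompOut A B u v = A (B u v) := rfl

@[simp]
theorem precompFst_apply (A : E →L[ℝ] E) (B : E →L[ℝ] E →L[ℝ] E) (u v : E) :
    precompFst A B u v = B (A u) v := rfl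

@[simp]
theorem precompSnd_apply (A : E →L[ℝ] E) (B : E →L[ℝ] E →L[ℝ] E) (u v : E) :
    precompSnd A B u v = B u (A v) := rfl

@[simp]
theorem swapArgs_apply (B : E →L[ℝ] E →L[ℝ] E) (u v : E) :
    swapArgs B u v = B v u := rfl

theorem commute_postcompOut_precompFst (A A' : E →L[ℝ] E) :
    Commute (postcompOut A) (precompFst A') := by
  ext B u v; simp

theorem commute_postcompOut_precompSnd (A A' : E →L[ℝ] E) :
    Commute (postcompOut A) (precompSnd A') := by
  ext B u v; simp

theorem commute_precompFst_precompSnd (A A' : E →L[ℝ] E) :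
    Commute (precompFst A) (precompSnd A') := by
  ext B u v; simp

theorem swapArgs_semiconj_postcompOut (A : E →L[ℝ] E) :
    SemiconjBy swapArgs (postcompOut A) (postcompOut A) := by
  ext B u v; simp

theorem swapArgs_semiconj_precompFst (A : E →L[ℝ] E) :
    SemiconjBy swapArgs (precompFst A) (precompSnd A) := by
  ext B u v; simp

theorem swapArgs_semiconj_precompSnd (A : E →L[ℝ] E) :
    SemiconjBy swapArgs (precompSnd A) (precompFst A) := by
  ext B u v; simp

theorem postcompOut_pow (A : E →L[ℝ] E) (n : ℕ) : postcompOut (A ^ n) = postcompOut A ^ n := by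
  induction n with
  | zero => ext B u v; simp
  | succ n ih => rw [pow_succ, pow_succ, ← ih]; ext B u v; simp

theorem precompFst_pow (A : E →L[ℝ] E) (n : ℕ) : precompFst (A ^ n) = precompFst A ^ n := by
  induction n with
  | zero => ext B u v; simp
  | succ n ih => rw [pow_succ, pow_succ', ← ih]; ext B u v; simp

theorem precompSnd_pow (A : E →L[ℝ] E) (n : ℕ) : precompSnd (A ^ n) = precompSnd A ^ n := by
  induction n with
  | zero => ext B u v; simp
  | succ n ih => rw [pow_succ, pow_succ', ← ih]; ext B u v; simp

theorem postcompOut_sum_smul_pow (A : E →L[ℝ] E) (s : Finset ℕ) (c : ℕ → ℝ) :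
    postcompOut (∑ j ∈ s, c j • A ^ j) = ∑ j ∈ s, c j • postcompOut A ^ j := by
  simp_rw [← postcompOut_pow]
  ext B u v; simp

theorem precompFst_sum_smul_pow (A : E →L[ℝ] E) (s : Finset ℕ) (c : ℕ → ℝ) :
    precompFst (∑ j ∈ s, c j • A ^ j) = ∑ j ∈ s, c j • precompFst A ^ j := by
  simp_rw [← precompFst_pow]
  ext B u v; simp

theorem precompSnd_sum_smul_pow (A : E →L[ℝ] E) (s : Finset ℕ) (c : ℕ → ℝ) :
    precompSnd (∑ j ∈ s, c j • A ^ j) = ∑ j ∈ s, c j • precompSnd A ^ j := by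
  simp_rw [← precompSnd_pow]
  ext B u v; simp

theorem mul_pow_two_mul_of_commute {R : Type*} [Ring R] {d g g' : R} (hg : Commute d g)
    (hg' : Commute d g') (e : R) :
    (g * d) ^ 2 * (g' * (g' * e)) = g ^ 2 * g' ^ 2 * (d ^ 2 * e) := by
  have h := (hg'.pow_pow 2 2).eq
  calc (g * d) ^ 2 * (g' * (g' * e)) = g ^ 2 * (d ^ 2 * g' ^ 2) * e := by
        rw [hg.symm.mul_pow]; noncomm_ring
    _ = g ^ 2 * g' ^ 2 * (d ^ 2 * e) := by rw [h]; noncomm_ring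

/-- The divided difference `(f(a) - f(b)) / (a - b)` of the polynomial `f = ∑ j ∈ s, c j X ^ j`. -/
noncomputable def dividedDiff {R : Type*} [Ring R] [Algebra ℝ R] (s : Finset ℕ) (c : ℕ → ℝ)
    (a b : R) : R :=
  ∑ j ∈ s, c j • ∑ i ∈ Finset.range j, a ^ i * b ^ (j - 1 - i)

section DividedDiff

variable {R : Type*} [Ring R] [Algebra ℝ R] (s : Finset ℕ) (c : ℕ → ℝ)

theorem dividedDiff_mul_sub {a b : R} (h : Commute a b) :
    dividedDiff s c a b * (a - b) = ∑ j ∈ s, c j • a ^ j - ∑ j ∈ s, c j • b ^ j := by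
  simp_rw [dividedDiff, Finset.sum_mul, smul_mul_assoc, h.geom_sum₂_mul, smul_sub,
    Finset.sum_sub_distrib]

theorem SemiconjBy.dividedDiff_right {t a b a' b' : R} (ha : SemiconjBy t a a')
    (hb : SemiconjBy t b b') :
    SemiconjBy t (dividedDiff s c a b) (dividedDiff s c a' b') := by
  have h : ∀ j i : ℕ, t * (a ^ i * b ^ (j - 1 - i)) = a' ^ i * b' ^ (j - 1 - i) * t :=
    fun j i => (ha.pow_right i).mul_right (hb.pow_right (j - 1 - i))
  simp only [SemiconjBy, dividedDiff, Finset.mul_sum, Finset.sum_mul, mul_smul_comm,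
    smul_mul_assoc, h]

theorem Commute.dividedDiff_right {t a b : R} (ha : Commute t a) (hb : Commute t b) :
    Commute t (dividedDiff s c a b) :=
  SemiconjBy.dividedDiff_right s c ha hb

theorem commute_sub_dividedDiff {a b d : R} (hab : Commute a b) (had : Commute a d)
    (hbd : Commute b d) : Commute (a - b) (dividedDiff s c a d) :=
  ((Commute.refl a).sub_left hab.symm).dividedDiff_right s c (had.sub_left hbd)

end DividedDiff

/-- Let `o`, `p`, `q` commute and let `t` fix `o` and exchange `p` and `q`. If `t` fixes
`(o - p)² (o - q) B`, then it fixes the same expression formed with `f(o)`, `f(p)`, `f(q)` for a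
polynomial `f`, applied to any `C` with `(o - q) C = (f(o) - f(q)) B`. -/
theorem semiconj_apply_polynomial_differences {M : Type*} [AddCommGroup M] [Module ℝ M]
    {o p q t : Module.End ℝ M} (hop : Commute o p) (hoq : Commute o q) (hpq : Commute p q)
    (hto : SemiconjBy t o o) (htp : SemiconjBy t p q) (htq : SemiconjBy t q p)
    (s : Finset ℕ) (c : ℕ → ℝ) {B B' : M}
    (hB : (o - q) B' = (∑ j ∈ s, c j • o ^ j - ∑ j ∈ s, c j • q ^ j) B)
    (ht : t (((o - p) ^ 2 * (o - q)) B) = ((o - p) ^ 2 * (o - q)) B) :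
    t (((∑ j ∈ s, c j • o ^ j - ∑ j ∈ s, c j • p ^ j) ^ 2 *
        (∑ j ∈ s, c j • o ^ j - ∑ j ∈ s, c j • q ^ j)) B') =
      ((∑ j ∈ s, c j • o ^ j - ∑ j ∈ s, c j • p ^ j) ^ 2 *
        (∑ j ∈ s, c j • o ^ j - ∑ j ∈ s, c j • q ^ j)) B' := by
  rw [← dividedDiff_mul_sub s c hoq] at hB ⊢
  rw [← dividedDiff_mul_sub s c hop]
  have hfactor : ((dividedDiff s c o p * (o - p)) ^ 2 * (dividedDiff s c o q * (o - q))) B' =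
      (dividedDiff s c o p ^ 2 * dividedDiff s c o q ^ 2) (((o - p) ^ 2 * (o - q)) B) := by
    rw [Module.End.mul_apply, Module.End.mul_apply, hB, ← Module.End.mul_apply,
      ← Module.End.mul_apply, ← Module.End.mul_apply, mul_assoc,
      mul_pow_two_mul_of_commute (commute_sub_dividedDiff s c hop hop (Commute.refl p))
        (commute_sub_dividedDiff s c hop hoq hpq)]
  have hcomm : Commute (dividedDiff s c o p) (dividedDiff s c o q) :=
    Commute.dividedDiff_right s c
      (Commute.dividedDiff_right s c (Commute.refl o) hop).symm
      (Commute.dividedDiff_right s c hoq.symm hpq.symm).symm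
  have h₁ := (SemiconjBy.dividedDiff_right s c hto htp).pow_right 2
  have h₂ := (SemiconjBy.dividedDiff_right s c hto htq).pow_right 2
  rw [hfactor, ← Module.End.mul_apply, (h₁.mul_right h₂).eq, Module.End.mul_apply, ht,
    (hcomm.pow_pow 2 2).eq]

/-- The bilinear map whose antisymmetrization is, up to sign, the Haantjes tensor of a field of
operators with value `A` and derivative `B` at a point. -/
noncomputable def haantjesPotential (A : E →L[ℝ] E) (B : E →L[ℝ] E →L[ℝ] E) :
    E →L[ℝ] E →L[ℝ] E :=
  ((postcompOut A - precompFst A) ^ 2 * (postcompOut A - precompSnd A)) B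

theorem swapArgs_haantjesPotential_sum_smul_pow (A : E →L[ℝ] E) (B B' : E →L[ℝ] E →L[ℝ] E)
    (s : Finset ℕ) (c : ℕ → ℝ)
    (hB : (postcompOut A - precompSnd A) B' =
      (postcompOut (∑ j ∈ s, c j • A ^ j) - precompSnd (∑ j ∈ s, c j • A ^ j)) B)
    (hsymm : swapArgs (haantjesPotential A B) = haantjesPotential A B) :
    swapArgs (haantjesPotential (∑ j ∈ s, c j • A ^ j) B') =
      haantjesPotential (∑ j ∈ s, c j • A ^ j) B' := by
  rw [postcompOut_sum_smul_pow, precompSnd_sum_smul_pow] at hB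
  rw [haantjesPotential, postcompOut_sum_smul_pow, precompFst_sum_smul_pow,
    precompSnd_sum_smul_pow]
  exact semiconj_apply_polynomial_differences (commute_postcompOut_precompFst A A)
    (commute_postcompOut_precompSnd A A) (commute_precompFst_precompSnd A A)
    (swapArgs_semiconj_postcompOut A) (swapArgs_semiconj_precompFst A)
    (swapArgs_semiconj_precompSnd A) s c hB hsymm

theorem hasFDerivAt_opVec {L : E → (E →L[ℝ] E)} {X : E → E} {x : E}
    (hL : DifferentiableAt ℝ L x) (hX : DifferentiableAt ℝ X x) :
    HasFDerivAt (opVec L X) ((L x).comp (fderiv ℝ X x) + (fderiv ℝ L x).flip (X x)) x :=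
  hL.hasFDerivAt.clm_apply hX.hasFDerivAt

theorem nijenhuisTorsion_eq {L : E → (E →L[ℝ] E)} {X Y : E → E} {x : E}
    (hL : DifferentiableAt ℝ L x) (hX : DifferentiableAt ℝ X x) (hY : DifferentiableAt ℝ Y x) :
    nijenhuisTorsion L X Y x =
      fderiv ℝ L x (L x (X x)) (Y x) - fderiv ℝ L x (L x (Y x)) (X x)
        - L x (fderiv ℝ L x (X x) (Y x) - fderiv ℝ L x (Y x) (X x)) := by
  simp only [nijenhuisTorsion, lieBracket, (hasFDerivAt_opVec hL hX).fderiv,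
    (hasFDerivAt_opVec hL hY).fderiv]
  simp only [opVec, map_add, map_sub, add_apply, ContinuousLinearMap.comp_apply,
    ContinuousLinearMap.flip_apply]
  abel

theorem haantjesTensor_eq {L : E → (E →L[ℝ] E)} {X Y : E → E} {x : E}
    (hL : DifferentiableAt ℝ L x) (hX : DifferentiableAt ℝ X x) (hY : DifferentiableAt ℝ Y x) :
    haantjesTensor L X Y x =
      haantjesPotential (L x) (fderiv ℝ L x) (Y x) (X x)
        - haantjesPotential (L x) (fderiv ℝ L x) (X x) (Y x) := by
  have hLX := (hasFDerivAt_opVec hL hX).differentiableAt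
  have hLY := (hasFDerivAt_opVec hL hY).differentiableAt
  simp only [haantjesTensor, nijenhuisTorsion_eq hL hX hY, nijenhuisTorsion_eq hL hLX hLY,
    nijenhuisTorsion_eq hL hX hLY, nijenhuisTorsion_eq hL hLX hY]
  simp only [opVec, haantjesPotential, pow_two, Module.End.mul_apply, LinearMap.sub_apply,
    sub_apply, map_add, map_sub, postcompOut_apply, precompFst_apply,
    precompSnd_apply]
  abel

/-- Differentiating the relation `L P = P L` between two commuting fields of operators. -/
theorem postcompOut_sub_precompSnd_fderiv {L P : E → (E →L[ℝ] E)} {x : E}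
    (hL : DifferentiableAt ℝ L x) (hP : DifferentiableAt ℝ P x)
    (hcomm : ∀ y, Commute (L y) (P y)) :
    (postcompOut (L x) - precompSnd (L x)) (fderiv ℝ P x) =
      (postcompOut (P x) - precompSnd (P x)) (fderiv ℝ L x) := by
  have h₁ := hL.hasFDerivAt.clm_comp hP.hasFDerivAt
  have h₂ := hP.hasFDerivAt.clm_comp hL.hasFDerivAt
  have h : (fun y => (L y).comp (P y)) = fun y => (P y).comp (L y) := funext hcomm
  rw [h] at h₁
  ext u v
  have huv := DFunLike.congr_fun (DFunLike.congr_fun (h₁.unique h₂) u) v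
  simp at huv
  simp [sub_eq_sub_iff_add_eq_add, huv]

/-- If `P` commutes with `L` and is a polynomial in `L` at the point `x`, then the Haantjes tensor
of `P` vanishes at `x` as soon as the one of `L` does. -/
theorem haantjesTensor_eq_zero_of_commute {L P : E → (E →L[ℝ] E)} {X Y : E → E} {x : E}
    (hL : DifferentiableAt ℝ L x) (hP : DifferentiableAt ℝ P x)
    (hX : DifferentiableAt ℝ X x) (hY : DifferentiableAt ℝ Y x)
    (hcomm : ∀ y, Commute (L y) (P y)) (s : Finset ℕ) (c : ℕ → ℝ)
    (hPx : P x = ∑ j ∈ s, c j • L x ^ j)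
    (hHaan : ∀ u v : E, haantjesTensor L (fun _ => u) (fun _ => v) x = 0) :
    haantjesTensor P X Y x = 0 := by
  have hsymm : swapArgs (haantjesPotential (L x) (fderiv ℝ L x)) =
      haantjesPotential (L x) (fderiv ℝ L x) := by
    ext u v
    have h := hHaan u v
    rw [haantjesTensor_eq hL (differentiableAt_const u) (differentiableAt_const v)] at h
    exact sub_eq_zero.mp h
  have hB := postcompOut_sub_precompSnd_fderiv hL hP hcomm
  rw [hPx] at hB
  have h := swapArgs_haantjesPotential_sum_smul_pow _ _ _ s c hB hsymm
  rw [haantjesTensor_eq hP hX hY, hPx, sub_eq_zero, ← swapArgs_apply, h]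

/-- Paper, Proposition 2.9: if the Haantjes tensor of `L` vanishes
identically on `U`, then for any polynomial `Σ_{j=0}^m a_j(x)·L(x)^j` in `L` with smooth
coefficients, the associated Haantjes tensor also vanishes identically on `U`. -/
theorem haantjes_polynomial {E : Type*} [NormedAddCommGroup E] [NormedSpace ℝ E]
    [FiniteDimensional ℝ E]
    (U : Set E) (hU : IsOpen U)
    (L : E → (E →L[ℝ] E)) (hL : ContDiffOn ℝ (⊤ : ℕ∞) L U)
    (hHaan : ∀ X Y : E → E, ContDiffOn ℝ (⊤ : ℕ∞) X U → ContDiffOn ℝ (⊤ : ℕ∞) Y U →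
      ∀ x ∈ U, haantjesTensor L X Y x = 0)
    (m : ℕ) (a : ℕ → E → ℝ) (ha : ∀ j ≤ m, ContDiffOn ℝ (⊤ : ℕ∞) (a j) U) :
    ∀ X Y : E → E, ContDiffOn ℝ (⊤ : ℕ∞) X U → ContDiffOn ℝ (⊤ : ℕ∞) Y U →
      ∀ x ∈ U,
        haantjesTensor (fun y => ∑ j ∈ Finset.range (m + 1), a j y • (L y) ^ j) X Y x = 0 := by
  intro X Y hX hY x hx
  have hLx : DifferentiableAt ℝ L x :=
    (hL.contDiffAt (hU.mem_nhds hx)).differentiableAt (by simp)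
  have hPx : DifferentiableAt ℝ (fun y => ∑ j ∈ Finset.range (m + 1), a j y • (L y) ^ j) x := by
    refine DifferentiableAt.fun_sum fun j hj => ?_
    have haj : DifferentiableAt ℝ (a j) x :=
      ((ha j (by simpa [Nat.lt_succ_iff] using hj)).contDiffAt
        (hU.mem_nhds hx)).differentiableAt (by simp)
    exact haj.smul (hLx.pow j)
  have hcomm : ∀ y, Commute (L y) (∑ j ∈ Finset.range (m + 1), a j y • (L y) ^ j) := fun y =>
    Commute.sum_right _ _ _ fun j _ => ((Commute.refl (L y)).pow_right j).smul_right (a j y)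
  exact haantjesTensor_eq_zero_of_commute hLx hPx
    ((hX.contDiffAt (hU.mem_nhds hx)).differentiableAt (by simp))
    ((hY.contDiffAt (hU.mem_nhds hx)).differentiableAt (by simp))
    hcomm (Finset.range (m + 1)) (fun j => a j x) rfl
    fun u v => hHaan _ _ contDiffOn_const contDiffOn_const x hx
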